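/- Let V be a real vector space of finite dimension n ≥ 1 and m ≥ 0 an integer. Then the dimension of the space of symmetric normal tensors is dim C̃_m(V) = n·(n(n+1)/2)·binom(n+m−1, m) − n·binom(n+m+1, m+2). -/

import Mathlib

open scoped BigOperators

/-- `C̃_m(V)`: the space of symmetric normal tensors of order `m`: `(m+2)`-multilinear
maps `T : V^{m+2} → V` that are symmetric in their first two arguments, symmetric in
their last `m` arguments, and whose total symmetrization vanishes. -/
def SymNormalTensor (V : Type*) [AddCommGroup V] [Module ℝ V] (m : ℕ) :
    Submodule ℝ (MultilinearMap ℝ (fun _ : Fin (m + 2) => V) V) where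
  carrier := {T |
    (∀ v : Fin (m + 2) → V, T (fun i => v (Equiv.swap 0 1 i)) = T v) ∧
    (∀ (v : Fin (m + 2) → V) (σ : Equiv.Perm (Fin (m + 2))),
        (∀ i : Fin (m + 2), (i : ℕ) < 2 → σ i = i) → T (fun i => v (σ i)) = T v) ∧
    (∀ v : Fin (m + 2) → V,
        ∑ σ : Equiv.Perm (Fin (m + 2)), T (fun i => v (σ i)) = 0)}
  add_mem' := by
    rintro a b ⟨ha0, ha1, ha2⟩ ⟨hb0, hb1, hb2⟩
    refine ⟨fun v => by simp [ha0 v, hb0 v], fun v σ hσ => by simp [ha1 v σ hσ, hb1 v σ hσ],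
      fun v => ?_⟩
    simp [Finset.sum_add_distrib, ha2 v, hb2 v]
  zero_mem' := by
    refine ⟨fun v => ?_, fun v σ hσ => ?_, fun v => ?_⟩ <;> simp
  smul_mem' := by
    rintro c a ⟨ha0, ha1, ha2⟩
    refine ⟨fun v => by simp [ha0 v], fun v σ hσ => by simp [ha1 v σ hσ], fun v => ?_⟩
    simp [← Finset.smul_sum, ha2 v]

namespace SymNormalTensor

/-- The multiset of values of a finite tuple. -/
def tupleSym {ι : Type*} {k : ℕ} (f : Fin k → ι) : Sym ι k :=
  ⟨Finset.univ.val.map f, by simp⟩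

theorem tupleSym_surjective {ι : Type*} {k : ℕ} :
    Function.Surjective (tupleSym : (Fin k → ι) → Sym ι k) := by
  rintro ⟨s, hs⟩
  obtain ⟨l, rfl⟩ := Quot.exists_rep s
  obtain rfl : l.length = k := hs
  refine ⟨l.get, Subtype.ext ?_⟩
  simp [tupleSym, Fin.univ_def]

theorem tupleSym_eq_iff {ι : Type*} {k : ℕ} {f g : Fin k → ι} :
    tupleSym f = tupleSym g ↔ ∃ σ : Equiv.Perm (Fin k), f = g ∘ σ := by
  classical
  constructor
  · intro h
    have hcard (a : ι) : Nonempty ({ c // f c = a } ≃ { c // g c = a }) := by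
      rw [← Fintype.card_eq, Fintype.card_subtype, Fintype.card_subtype]
      have := congrArg (fun s : Sym ι k => Multiset.count a (s : Multiset ι)) h
      simp only [tupleSym, Sym.coe_mk, Multiset.count_map, eq_comm (a := a)] at this
      exact this
    exact ⟨Equiv.ofFiberEquiv fun a => (hcard a).some,
      funext fun c => (Equiv.ofFiberEquiv_map _ c).symm⟩
  · rintro ⟨σ, rfl⟩
    apply Subtype.ext
    change Multiset.map (g ∘ σ) Finset.univ.val = Multiset.map g Finset.univ.val
    rw [← Multiset.map_map, Multiset.map_univ_val_equiv]

theorem tupleSym_comp_perm {ι : Type*} {k : ℕ} (f : Fin k → ι) (σ : Equiv.Perm (Fin k)) :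
    tupleSym (f ∘ σ) = tupleSym f :=
  tupleSym_eq_iff.2 ⟨σ, rfl⟩

/-- The first two and the last `m` of the `m + 2` argument positions. -/
def splitEquiv (m : ℕ) : Fin 2 ⊕ Fin m ≃ Fin (m + 2) :=
  finSumFinEquiv.trans (finCongr (Nat.add_comm 2 m))

@[simp] theorem splitEquiv_inl_val (m : ℕ) (i : Fin 2) :
    (splitEquiv m (Sum.inl i) : ℕ) = i := by
  simp [splitEquiv]

@[simp] theorem splitEquiv_inr_val (m : ℕ) (j : Fin m) :
    (splitEquiv m (Sum.inr j) : ℕ) = 2 + j := by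
  simp [splitEquiv, Nat.add_comm]

theorem swap_splitEquiv_inr (m : ℕ) (j : Fin m) :
    Equiv.swap (0 : Fin (m + 2)) 1 (splitEquiv m (Sum.inr j)) = splitEquiv m (Sum.inr j) := by
  apply Equiv.swap_apply_of_ne_of_ne <;> intro h
  all_goals
    have := congrArg Fin.val h
    rw [splitEquiv_inr_val] at this
    simp at this
  omega

/-- The multiset of the first two entries and the multiset of the last `m` entries. -/
def splitSym {ι : Type*} {m : ℕ} (f : Fin (m + 2) → ι) : Sym ι 2 × Sym ι m :=
  (tupleSym fun i => f (splitEquiv m (Sum.inl i)), tupleSym fun j => f (splitEquiv m (Sum.inr j)))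

theorem splitSym_surjective {ι : Type*} {m : ℕ} :
    Function.Surjective (splitSym : (Fin (m + 2) → ι) → Sym ι 2 × Sym ι m) := by
  rintro ⟨s, t⟩
  obtain ⟨f, rfl⟩ := tupleSym_surjective s
  obtain ⟨g, rfl⟩ := tupleSym_surjective t
  exact ⟨Sum.elim f g ∘ (splitEquiv m).symm, by simp [splitSym]⟩

theorem splitSym_append {ι : Type*} {m : ℕ} (f : Fin (m + 2) → ι) :
    ((splitSym f).1 : Multiset ι) + ((splitSym f).2 : Multiset ι) = (tupleSym f : Multiset ι) := by
  have h : (Finset.univ : Finset (Fin (m + 2))) = Finset.univ.map (splitEquiv m).toEmbedding := by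
    simp
  change _ = Finset.univ.val.map f
  rw [h]
  simp [splitSym, tupleSym, ← Finset.univ_disjSum_univ, Finset.disjSum, Multiset.disjSum,
    Function.comp_def]

theorem splitSym_comp_swap {ι : Type*} {m : ℕ} (f : Fin (m + 2) → ι) :
    splitSym (f ∘ Equiv.swap 0 1) = splitSym f := by
  have h2 : (splitSym (f ∘ Equiv.swap 0 1)).2 = (splitSym f).2 := by
    simp [splitSym, swap_splitEquiv_inr]
  have h := splitSym_append (f ∘ Equiv.swap 0 1)
  rw [tupleSym_comp_perm, ← splitSym_append f, h2] at h
  exact Prod.ext (Subtype.ext (add_right_cancel h)) h2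

theorem splitSym_comp_perm {ι : Type*} {m : ℕ} (f : Fin (m + 2) → ι)
    (σ : Equiv.Perm (Fin (m + 2))) (hσ : ∀ i : Fin (m + 2), (i : ℕ) < 2 → σ i = i) :
    splitSym (f ∘ σ) = splitSym f := by
  have h1 : (splitSym (f ∘ σ)).1 = (splitSym f).1 := by
    have (i : Fin 2) : σ (splitEquiv m (Sum.inl i)) = splitEquiv m (Sum.inl i) :=
      hσ _ (by simpa using i.isLt)
    simp [splitSym, this]
  have h := splitSym_append (f ∘ σ)
  rw [tupleSym_comp_perm, ← splitSym_append f, h1] at h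
  exact Prod.ext h1 (Subtype.ext (add_left_cancel h))

/-- Tuples with the same split multisets are related by permuting the last `m` positions and
possibly exchanging the first two. -/
theorem exists_perm_of_splitSym_eq {ι : Type*} {m : ℕ} {f g : Fin (m + 2) → ι}
    (h : splitSym f = splitSym g) :
    ∃ σ : Equiv.Perm (Fin (m + 2)), (∀ i : Fin (m + 2), (i : ℕ) < 2 → σ i = i) ∧
      (f = g ∘ σ ∨ f = (g ∘ σ) ∘ Equiv.swap 0 1) := by
  obtain ⟨τ, hτ⟩ := tupleSym_eq_iff.1 (congrArg Prod.fst h)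
  obtain ⟨ρ, hρ⟩ := tupleSym_eq_iff.1 (congrArg Prod.snd h)
  have e0 : splitEquiv m (Sum.inl 0) = 0 := Fin.ext (by simp)
  have e1 : splitEquiv m (Sum.inl 1) = 1 := Fin.ext (by simp)
  let σ := (splitEquiv m).permCongr (Equiv.sumCongr (Equiv.refl _) ρ)
  have hl (i : Fin 2) : σ (splitEquiv m (Sum.inl i)) = splitEquiv m (Sum.inl i) := by simp [σ]
  have hr (j : Fin m) : σ (splitEquiv m (Sum.inr j)) = splitEquiv m (Sum.inr (ρ j)) := by
    simp [σ]
  refine ⟨σ, fun i hi => ?_, ?_⟩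
  · obtain ⟨i | j, rfl⟩ := (splitEquiv m).surjective i
    · exact hl i
    · rw [splitEquiv_inr_val] at hi
      omega
  · have key : ∀ π : Equiv.Perm (Fin (m + 2)),
        (∀ j : Fin m, π (splitEquiv m (Sum.inr j)) = splitEquiv m (Sum.inr j)) →
        (∀ i : Fin 2, π (splitEquiv m (Sum.inl i)) = splitEquiv m (Sum.inl (τ i))) →
        f = (g ∘ σ) ∘ π := by
      intro π hπr hπl
      funext x
      obtain ⟨i | j, rfl⟩ := (splitEquiv m).surjective x
      · simpa [hπl, hl] using congrFun hτ i
      · simpa [hπr, hr] using congrFun hρ j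
    have hcases : τ = 1 ∨ τ = Equiv.swap 0 1 := by
      clear * -
      revert τ
      decide
    rcases hcases with rfl | rfl
    · exact Or.inl (key 1 (fun _ => rfl) fun _ => rfl)
    · refine Or.inr (key _ (swap_splitEquiv_inr m) fun i => ?_)
      fin_cases i <;> simp [e0, e1]

variable {ι V : Type*} [AddCommGroup V] [Module ℝ V] {m : ℕ}

/-- The multilinear map with given coefficients in a basis, the coefficients depending only on the
split multisets of the indices. -/
noncomputable def ofCoeff [Fintype ι] (b : Module.Basis ι ℝ V) :
    (Sym ι 2 × Sym ι m → V) →ₗ[ℝ] MultilinearMap ℝ (fun _ : Fin (m + 2) => V) V where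
  toFun d := ∑ f : Fin (m + 2) → ι,
    ((MultilinearMap.mkPiAlgebra ℝ (Fin (m + 2)) ℝ).compLinearMap
      fun i => b.coord (f i)).smulRight (d (splitSym f))
  map_add' d d' := by ext; simp [Finset.sum_add_distrib]
  map_smul' c d := by ext; simp [Finset.smul_sum, smul_comm c]

theorem ofCoeff_basis [Fintype ι] (b : Module.Basis ι ℝ V) (d : Sym ι 2 × Sym ι m → V)
    (f : Fin (m + 2) → ι) : ofCoeff b d (fun i => b (f i)) = d (splitSym f) := by
  classical
  simp only [ofCoeff, LinearMap.coe_mk, AddHom.coe_mk, sum_apply,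
    MultilinearMap.smulRight_apply, MultilinearMap.compLinearMap_apply,
    MultilinearMap.mkPiAlgebra_apply, Module.Basis.coord_apply, Module.Basis.repr_self]
  rw [Finset.sum_eq_single f]
  · simp
  · intro g _ hg
    obtain ⟨i, hi⟩ := Function.ne_iff.1 hg
    rw [Finset.prod_eq_zero (Finset.mem_univ i), zero_smul]
    simp [Ne.symm hi]
  · simp

theorem ofCoeff_injective [Fintype ι] (b : Module.Basis ι ℝ V) :
    Function.Injective (ofCoeff (m := m) b) := by
  intro d d' h
  funext x
  obtain ⟨f, rfl⟩ := splitSym_surjective x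
  rw [← ofCoeff_basis b d, ← ofCoeff_basis b d', h]

/-- Total symmetrization at the level of coefficients. -/
noncomputable def symmetrize (ι V : Type*) [AddCommGroup V] [Module ℝ V] (m : ℕ) :
    (Sym ι 2 × Sym ι m → V) →ₗ[ℝ] (Sym ι (m + 2) → V) where
  toFun d s := ∑ σ : Equiv.Perm (Fin (m + 2)),
    d (splitSym (Function.surjInv tupleSym_surjective s ∘ σ))
  map_add' d d' := by ext; simp [Finset.sum_add_distrib]
  map_smul' c d := by ext; simp [Finset.smul_sum]

theorem symmetrize_tupleSym (d : Sym ι 2 × Sym ι m → V) (f : Fin (m + 2) → ι) :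
    symmetrize ι V m d (tupleSym f) =
      ∑ σ : Equiv.Perm (Fin (m + 2)), d (splitSym (f ∘ σ)) := by
  obtain ⟨ρ, hρ⟩ := tupleSym_eq_iff.1
    (Function.surjInv_eq (tupleSym_surjective (ι := ι)) (tupleSym f))
  simp only [symmetrize, LinearMap.coe_mk, AddHom.coe_mk, hρ]
  exact Fintype.sum_equiv (Equiv.mulLeft ρ) _ _ fun σ => rfl

theorem symmetrize_surjective : Function.Surjective (symmetrize ι V m) := by
  intro e
  refine ⟨fun x => ((Nat.factorial (m + 2) : ℝ)⁻¹) •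
    e ((x.1.append x.2).cast (Nat.add_comm 2 m)), ?_⟩
  funext s
  obtain ⟨f, rfl⟩ := tupleSym_surjective s
  have h (g : Fin (m + 2) → ι) :
      ((splitSym g).1.append (splitSym g).2).cast (Nat.add_comm 2 m) = tupleSym g :=
    Subtype.ext (splitSym_append g)
  rw [symmetrize_tupleSym]
  simp only [h, tupleSym_comp_perm, Finset.sum_const, Finset.card_univ, Fintype.card_perm,
    Fintype.card_fin]
  rw [← Nat.cast_smul_eq_nsmul ℝ, smul_smul, mul_inv_cancel₀, one_smul]
  exact_mod_cast Nat.factorial_ne_zero _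

theorem eq_map_ker [Fintype ι] (b : Module.Basis ι ℝ V) :
    SymNormalTensor V m = (LinearMap.ker (symmetrize ι V m)).map (ofCoeff b) := by
  ext T
  rw [Submodule.mem_map]
  constructor
  · rintro ⟨h0, h1, h2⟩
    let d : Sym ι 2 × Sym ι m → V := fun x =>
      T fun i => b (Function.surjInv splitSym_surjective x i)
    have hd (f : Fin (m + 2) → ι) : d (splitSym f) = T fun i => b (f i) := by
      obtain ⟨σ, hσ, h | h⟩ := exists_perm_of_splitSym_eq
        (Function.surjInv_eq (splitSym_surjective (ι := ι)) (splitSym f))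
      · simp only [d, h]
        exact h1 (fun i => b (f i)) σ hσ
      · simp only [d, h]
        exact (h0 fun i => b (f (σ i))).trans (h1 (fun i => b (f i)) σ hσ)
    refine ⟨d, ?_, Module.Basis.ext_multilinear (fun _ => b) fun f => ?_⟩
    · rw [LinearMap.mem_ker]
      funext s
      obtain ⟨f, rfl⟩ := tupleSym_surjective s
      rw [symmetrize_tupleSym]
      simp only [hd]
      exact h2 fun i => b (f i)
    · exact (ofCoeff_basis b d f).trans (hd f)
  · rintro ⟨d, hd, rfl⟩
    have hperm (σ : Equiv.Perm (Fin (m + 2)))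
        (h : ∀ f : Fin (m + 2) → ι, splitSym (f ∘ σ) = splitSym f) (v : Fin (m + 2) → V) :
        ofCoeff b d (fun i => v (σ i)) = ofCoeff b d v := by
      have : (ofCoeff b d).domDomCongr σ = ofCoeff b d :=
        Module.Basis.ext_multilinear (fun _ => b) fun f => by
          rw [MultilinearMap.domDomCongr_apply, ofCoeff_basis b d f, ← h f]
          exact ofCoeff_basis b d (f ∘ σ)
      exact DFunLike.congr_fun this v
    refine ⟨hperm _ splitSym_comp_swap, fun v σ hσ => hperm σ (fun f => ?_) v, fun v => ?_⟩
    · exact splitSym_comp_perm f σ hσ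
    · have : ∑ σ : Equiv.Perm (Fin (m + 2)), (ofCoeff b d).domDomCongr σ = 0 :=
        Module.Basis.ext_multilinear (fun _ => b) fun f => by
          have h := (symmetrize_tupleSym d f).symm.trans
            (congrFun (LinearMap.mem_ker.1 hd) (tupleSym f))
          simp only [sum_apply, MultilinearMap.domDomCongr_apply,
            zero_apply]
          exact (Finset.sum_congr rfl fun (σ : Equiv.Perm _) _ => ofCoeff_basis b d (f ∘ σ)).trans h
      simpa using DFunLike.congr_fun this v

end SymNormalTensor

/-- The dimension of the space of symmetric normal tensors:
`dim C̃_m(V) = n·(n(n+1)/2)·C(n+m−1, m) − n·C(n+m+1, m+2)` where `n = dim V ≥ 1`. -/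
theorem finrank_symNormalTensor
    (V : Type*) [AddCommGroup V] [Module ℝ V] [FiniteDimensional ℝ V]
    (n : ℕ) (hn : 1 ≤ n) (hdim : Module.finrank ℝ V = n) (m : ℕ) :
    Module.finrank ℝ (SymNormalTensor V m) =
      n * (n * (n + 1) / 2) * Nat.choose (n + m - 1) m
        - n * Nat.choose (n + m + 1) (m + 2) := by
  let b := Module.finBasisOfFinrankEq ℝ V hdim
  rw [SymNormalTensor.eq_map_ker b,
    ← (Submodule.equivMapOfInjective _ (SymNormalTensor.ofCoeff_injective b) _).finrank_eq]
  have h := LinearMap.finrank_range_add_finrank_ker (SymNormalTensor.symmetrize (Fin n) V m)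
  rw [LinearMap.range_eq_top.2 SymNormalTensor.symmetrize_surjective, finrank_top,
    Module.finrank_pi_fintype, Module.finrank_pi_fintype] at h
  simp only [Finset.sum_const, Finset.card_univ, Fintype.card_prod, Sym.card_sym_eq_choose,
    Fintype.card_fin, hdim, smul_eq_mul] at h
  rw [show n + (m + 2) - 1 = n + m + 1 by omega, show n + 2 - 1 = n + 1 by omega,
    Nat.choose_two_right, Nat.add_sub_cancel] at h
  rw [Nat.mul_comm n (n + 1)]
  apply Nat.eq_sub_of_add_eq
  linarith
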